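/- arXiv:cs/0406024 — 2 statements merged into one kernel-verified Lean document; each statement's English description precedes it below -/
import Mathlib

section
/- For every integer k ≥ 0, every graph G with tree-width tw(G) ≤ k has a t_k-track layout, where t_k = 3^k · 6^{(4^k − 3k − 1)/9}; hence track-number is bounded by a function of tree-width. -/
open SimpleGraph

/-- A (proper) track layout of the graph `G` with `t` tracks.
`track v` is the track (colour class) of vertex `v`, and `pos v` gives the
position of `v` in the total order of its track. -/
structure TrackLayout (V : Type) (G : SimpleGraph V) (t : ℕ) where
  /-- the track containing each vertex -/
  track : V → Fin t
  /-- the position of each vertex within its track -/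
  pos : V → ℕ
  /-- distinct vertices on a common track occupy distinct positions -/
  inj : ∀ v w : V, track v = track w → pos v = pos w → v = w
  /-- the tracks form a proper vertex colouring -/
  proper : ∀ v w : V, G.Adj v w → track v ≠ track w
  /-- no X-crossing: there are no edges `vw` and `xy` with `v, x` on one track,
  `w, y` on another track, `v <ᵢ x` and `y <ⱼ w` -/
  noX : ∀ v w x y : V, G.Adj v w → G.Adj x y →
    track v = track x → track w = track y → track v ≠ track w →
    pos v < pos x → pos y < pos w → False
/-- A tree-decomposition of `G`: a (finite) tree together with bags `bag x ⊆ V`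
such that every vertex is in some bag, every edge has both end-vertices in a common
bag, and for every vertex the set of nodes whose bag contains it induces a connected
subtree. -/
structure TreeDecomp (V : Type) (G : SimpleGraph V) where
  /-- the index type of the nodes of the tree -/
  ι : Type
  finι : Fintype ι
  /-- the tree -/
  tree : SimpleGraph ι
  isTree : tree.IsTree
  /-- the bags -/
  bag : ι → Set V
  cover : ∀ v : V, ∃ x : ι, v ∈ bag x
  edgeCover : ∀ v w : V, G.Adj v w → ∃ x : ι, v ∈ bag x ∧ w ∈ bag x
  subtreeConnected : ∀ v : V, (tree.induce {x : ι | v ∈ bag x}).Connected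

/-- The tree-width of `G`: the minimum width (one less than the maximum bag size)
of a tree-decomposition of `G`. -/
noncomputable def treewidth (V : Type) (G : SimpleGraph V) : ℕ :=
  sInf {k : ℕ | ∃ D : TreeDecomp V G, ∀ x : D.ι, (D.bag x).ncard ≤ k + 1}

namespace TL

/-- Lexicographic combination of two natural-number keys. -/
lemma lexcomb {W : Type*} [Finite W] (f g : W → ℕ) :
    ∃ h : W → ℕ, ∀ u v, h u < h v ↔ (f u < f v ∨ (f u = f v ∧ g u < g v)) := by
  obtain ⟨M, hM⟩ := (Set.finite_range g).bddAbove
  have hM' : ∀ u, g u ≤ M := fun u => hM ⟨u, rfl⟩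
  refine ⟨fun u => f u * (M + 1) + g u, fun u v => ?_⟩
  have h1 := hM' u
  have h2 := hM' v
  rcases lt_trichotomy (f u) (f v) with h | h | h
  · have : (f u + 1) * (M + 1) ≤ f v * (M + 1) := Nat.mul_le_mul_right _ h
    simp only [h, true_or, iff_true]
    nlinarith
  · simp [h]
  · have : (f v + 1) * (M + 1) ≤ f u * (M + 1) := Nat.mul_le_mul_right _ h
    constructor
    · intro h'
      nlinarith
    · intro hcon
      omega

/-- A perfect elimination ordering of width at most `k`. -/
structure Elim {V : Type} (H : SimpleGraph V) (ord : V → ℕ) (k : ℕ) : Prop where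
  inj : Function.Injective ord
  clique : ∀ v u w, H.Adj u v → H.Adj w v → ord u < ord v → ord w < ord v → u ≠ w → H.Adj u w
  width : ∀ v, {u | H.Adj u v ∧ ord u < ord v}.ncard ≤ k

/-- A track layout with nicely ordered classes of cliques. -/
structure CL (V : Type) (H : SimpleGraph V) (α β : Type) where
  track : V → α
  pos : V → ℕ
  cl : Set V → β
  rank : Set V → ℕ
  inj : ∀ v w : V, track v = track w → pos v = pos w → v = w
  proper : ∀ v w : V, H.Adj v w → track v ≠ track w
  noX : ∀ v w x y : V, H.Adj v w → H.Adj x y →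
    track v = track x → track w = track y → pos v < pos x → pos y < pos w → False
  nice : ∀ C C' : Set V, H.IsClique C → H.IsClique C' → cl C = cl C' → rank C ≤ rank C' →
    ∀ v ∈ C, ∀ x ∈ C', track v = track x → pos v ≤ pos x

/-- The depth of a vertex. -/
noncomputable def depth {V : Type} (H : SimpleGraph V) (ord : V → ℕ) (v : V) : ℕ :=
  sInf (Set.range fun u : {u // H.Adj u v ∧ ord u < ord v} => depth H ord u.1 + 1)
termination_by ord v
decreasing_by exact u.2.2

/-- The graph of edges that stay in a layer. -/
def lay {V : Type} (H : SimpleGraph V) (ord : V → ℕ) : SimpleGraph V where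
  Adj u v := H.Adj u v ∧ depth H ord u = depth H ord v
  symm := ⟨fun _ _ h => ⟨h.1.symm, h.2.symm⟩⟩
  loopless := ⟨fun _ h => h.1.ne rfl⟩

open Classical in
/-- The first vertex of the component of a vertex in its layer. -/
noncomputable def root {V : Type} (H : SimpleGraph V) (ord : V → ℕ) (v : V) : V :=
  if h : ∃ u, (lay H ord).Adj u v ∧ ord u < ord v then root H ord h.choose else v
termination_by ord v
decreasing_by exact h.choose_spec.2

/-- Neighbours in the previous layer. -/
def P {V : Type} (H : SimpleGraph V) (ord : V → ℕ) (v : V) : Set V :=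
  {u | H.Adj u v ∧ depth H ord u + 1 = depth H ord v}

section
variable {V : Type} {H : SimpleGraph V} {ord : V → ℕ} {k : ℕ}

lemma depth_le {u v : V} (h : H.Adj u v) (ho : ord u < ord v) :
    depth H ord v ≤ depth H ord u + 1 := by
  conv_lhs => rw [depth]
  exact Nat.sInf_le ⟨⟨u, h, ho⟩, rfl⟩

lemma depth_ex {v : V} (h : ∃ u, H.Adj u v ∧ ord u < ord v) :
    ∃ u, H.Adj u v ∧ ord u < ord v ∧ depth H ord u + 1 = depth H ord v := by
  obtain ⟨u, hu⟩ := h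
  have := Nat.sInf_mem (s := (Set.range fun u : {u // H.Adj u v ∧ ord u < ord v} =>
    depth H ord u.1 + 1)) ⟨_, ⟨u, hu⟩, rfl⟩
  rw [← depth] at this
  obtain ⟨w, hw⟩ := this
  exact ⟨w.1, w.2.1, w.2.2, hw⟩

lemma depth_zero {v : V} (h : ¬ ∃ u, H.Adj u v ∧ ord u < ord v) : depth H ord v = 0 := by
  have : IsEmpty {u // H.Adj u v ∧ ord u < ord v} := ⟨fun u => h ⟨u.1, u.2⟩⟩
  rw [depth, Set.range_eq_empty]
  exact Nat.sInf_empty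

lemma Elim.ord_cases (hE : Elim H ord k) {u v : V} (h : H.Adj u v) :
    ord u < ord v ∨ ord v < ord u := by
  rcases lt_trichotomy (ord u) (ord v) with h1 | h1 | h1
  · exact Or.inl h1
  · exact absurd (hE.inj h1) h.ne
  · exact Or.inr h1

/-- Depth is 1-Lipschitz: for back-neighbours. -/
lemma Elim.depth_back (hE : Elim H ord k) : ∀ n, ∀ u v : V, ord v ≤ n → H.Adj u v →
    ord u < ord v → depth H ord u ≤ depth H ord v := by
  intro n
  induction n with
  | zero => intro u v h1 h2 h3; omega
  | succ n ih =>
    intro u v h1 h2 h3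
    obtain ⟨w, hw1, hw2, hw3⟩ := depth_ex (H := H) (ord := ord) ⟨u, h2, h3⟩
    by_cases huw : u = w
    · subst huw; omega
    have ha := hE.clique v u w h2 hw1 h3 hw2 huw
    rcases hE.ord_cases ha with h | h
    · have := ih u w (by omega) ha h
      omega
    · have := depth_le ha.symm h
      omega

lemma Elim.lip (hE : Elim H ord k) {u v : V} (h : H.Adj u v) :
    depth H ord u ≤ depth H ord v + 1 := by
  rcases hE.ord_cases h with h1 | h1
  · have := hE.depth_back _ u v le_rfl h h1
    omega
  · exact depth_le h.symm h1

/-- Neighbours of smaller depth come earlier. -/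
lemma Elim.P_ord (hE : Elim H ord k) {u v : V} (h : u ∈ P H ord v) : ord u < ord v := by
  obtain ⟨h1, h2⟩ := h
  rcases hE.ord_cases h1 with h | h
  · exact h
  · have := hE.depth_back _ v u le_rfl h1.symm h
    omega

lemma Elim.P_clique (hE : Elim H ord k) (v : V) : (lay H ord).IsClique (P H ord v) := by
  intro u hu w hw huw
  refine ⟨hE.clique v u w hu.1 hw.1 (hE.P_ord hu) (hE.P_ord hw) huw, ?_⟩
  have := hu.2
  have := hw.2
  omega

lemma Elim.P_sub (hE : Elim H ord k) {u v : V} (h : (lay H ord).Adj u v) (ho : ord u < ord v) :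
    P H ord v ⊆ P H ord u := by
  intro w hw
  have h1 := hw.2
  have h2 := h.2
  refine ⟨hE.clique v w u hw.1 h.1 (hE.P_ord hw) ho ?_, by omega⟩
  rintro rfl
  omega

lemma root_of {v : V} (h : ∃ u, (lay H ord).Adj u v ∧ ord u < ord v) :
    ∃ u, (lay H ord).Adj u v ∧ ord u < ord v ∧ root H ord v = root H ord u := by
  refine ⟨h.choose, h.choose_spec.1, h.choose_spec.2, ?_⟩
  conv_lhs => rw [root]
  simp [h]

lemma root_self {v : V} (h : ¬ ∃ u, (lay H ord).Adj u v ∧ ord u < ord v) :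
    root H ord v = v := by
  rw [root]
  simp [h]

lemma Elim.root_props (hE : Elim H ord k) : ∀ n, ∀ v : V, ord v ≤ n →
    depth H ord (root H ord v) = depth H ord v ∧ P H ord v ⊆ P H ord (root H ord v) ∧
    ∀ u, (lay H ord).Adj u v → ord u < ord v → root H ord u = root H ord v := by
  intro n
  induction n using Nat.strong_induction_on with
  | _ n ih =>
    intro v hv
    by_cases h : ∃ u, (lay H ord).Adj u v ∧ ord u < ord v
    · obtain ⟨w, hw1, hw2, hw3⟩ := root_of h
      obtain ⟨i1, i2, i3⟩ := ih (ord w) (by omega) w le_rfl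
      rw [hw3]
      refine ⟨i1.trans hw1.2, (hE.P_sub hw1 hw2).trans i2, ?_⟩
      intro u hu1 hu2
      by_cases huw : u = w
      · rw [huw]
      have ha : (lay H ord).Adj u w :=
        ⟨hE.clique v u w hu1.1 hw1.1 hu2 hw2 huw, hu1.2.trans hw1.2.symm⟩
      rcases hE.ord_cases ha.1 with h' | h'
      · exact i3 u ha h'
      · exact ((ih (ord u) (by omega) u le_rfl).2.2 w ha.symm h').symm
    · rw [root_self h]
      exact ⟨rfl, subset_rfl, fun u h1 h2 => absurd ⟨u, h1, h2⟩ h⟩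

lemma Elim.root_adj (hE : Elim H ord k) {u v : V} (h : (lay H ord).Adj u v) :
    root H ord u = root H ord v := by
  rcases hE.ord_cases h.1 with h' | h'
  · exact (hE.root_props _ v le_rfl).2.2 u h h'
  · exact ((hE.root_props _ u le_rfl).2.2 v h.symm h').symm

lemma Elim.lay_elim [Finite V] (hE : Elim H ord (k + 1)) : Elim (lay H ord) ord k where
  inj := hE.inj
  clique v u w h1 h2 h3 h4 h5 := ⟨hE.clique v u w h1.1 h2.1 h3 h4 h5, h1.2.trans h2.2.symm⟩
  width v := by
    by_cases h : ∃ u, H.Adj u v ∧ ord u < ord v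
    · obtain ⟨w, hw1, hw2, hw3⟩ := depth_ex h
      have : {u | (lay H ord).Adj u v ∧ ord u < ord v} ⊂ {u | H.Adj u v ∧ ord u < ord v} := by
        refine ⟨fun u hu => ⟨hu.1.1, hu.2⟩, fun hs => ?_⟩
        have := (hs (a := w) ⟨hw1, hw2⟩).1.2
        omega
      have h1 := Set.ncard_lt_ncard this (Set.toFinite _)
      have h2 := hE.width v
      omega
    · have : {u | (lay H ord).Adj u v ∧ ord u < ord v} = ∅ := by
        ext u
        simp only [Set.mem_ofPred_eq, Set.mem_empty_iff_false, iff_false]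
        exact fun hu => h ⟨u, hu.1.1, hu.2⟩
      rw [this]
      simp

/-- Base case. -/
lemma base [Finite V] (hE : Elim H ord 0) : Nonempty (CL V H Unit Unit) := by
  have hno : ∀ u v, ¬ H.Adj u v := by
    have : ∀ u v, H.Adj u v → ¬ ord u < ord v := by
      intro u v h ho
      have h1 := hE.width v
      rw [Nat.le_zero, Set.ncard_eq_zero (Set.toFinite _)] at h1
      have : u ∈ ({u | H.Adj u v ∧ ord u < ord v} : Set V) := ⟨h, ho⟩
      rw [h1] at this
      exact this
    intro u v h
    rcases hE.ord_cases h with h' | h'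
    · exact this u v h h'
    · exact this v u h.symm h'
  refine ⟨⟨fun _ => (), ord, fun _ => (), fun C => sInf (ord '' C), ?_, ?_, ?_, ?_⟩⟩
  · intro v w _ h
    exact hE.inj h
  · intro v w h
    exact absurd h (hno _ _)
  · intro v w x y h
    exact absurd h (hno _ _)
  · intro C C' hC hC' _ hr v hv v' hv' _
    have key : ∀ (C : Set V), H.IsClique C → ∀ v ∈ C, sInf (ord '' C) = ord v := by
      intro C hC v hv
      have : C = {v} := by
        ext w
        constructor
        · intro hw
          by_contra hne
          exact hno _ _ (hC hw hv hne)
        · rintro rfl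
          exact hv
      rw [this]
      simp
    rw [key C hC v hv, key C' hC' v' hv'] at hr
    exact hr

open Classical in
/-- A vertex in the parent component. -/
noncomputable def par (H : SimpleGraph V) (ord : V → ℕ) (v : V) : V :=
  if h : (P H ord (root H ord v)).Nonempty then h.some else v

lemma par_mem {v w : V} (h : w ∈ P H ord (root H ord v)) :
    par H ord v ∈ P H ord (root H ord v) := by
  have hne : (P H ord (root H ord v)).Nonempty := ⟨w, h⟩
  rw [par, dif_pos hne]
  exact hne.some_mem


/-- Order of the components. -/
noncomputable def key (H : SimpleGraph V) (ord : V → ℕ) (M : ℕ) (L : V → ℕ) : ℕ → V → ℕ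
  | 0, v => L (root H ord v)
  | d + 1, v => key H ord M L d (par H ord v) * M + L (root H ord v)

lemma mul_lex {M a b a' b' : ℕ} (hb : b < M) (h : a < a') : a * M + b < a' * M + b' := by
  have : (a + 1) * M ≤ a' * M := Nat.mul_le_mul_right _ h
  nlinarith

lemma exists_N [Finite V] (hE : Elim H ord k) (rk : V → ℕ) :
    ∃ N : V → ℕ,
      (∀ u v, root H ord u = root H ord v → N u = N v) ∧
      (∀ u v, (lay H ord).Adj u v → N u = N v) ∧
      (∀ u v v' w, depth H ord v = depth H ord v' → u ∈ P H ord v → w ∈ P H ord v' →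
        N u < N w → N v < N v') ∧
      (∀ u v v' w, depth H ord v = depth H ord v' → u ∈ P H ord v → w ∈ P H ord v' →
        N u = N w → rk (root H ord v) < rk (root H ord v') → N v < N v') := by
  obtain ⟨L, hL⟩ := lexcomb rk ord
  obtain ⟨M, hM⟩ := (Set.finite_range L).bddAbove
  have hM' : ∀ u, L u < M + 1 := fun u => Nat.lt_succ_of_le (hM ⟨u, rfl⟩)
  have hd : ∀ v, depth H ord (root H ord v) = depth H ord v :=
    fun v => (hE.root_props _ v le_rfl).1
  have hP : ∀ u v, u ∈ P H ord v → u ∈ P H ord (root H ord v) :=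
    fun u v h => (hE.root_props _ v le_rfl).2.1 h
  have hrr : ∀ u v, root H ord u = root H ord v →
      key H ord (M+1) L (depth H ord u) u = key H ord (M+1) L (depth H ord v) v := by
    intro u v h
    have h1 : depth H ord u = depth H ord v := by rw [← hd u, ← hd v, h]
    rw [h1]
    cases hn : depth H ord v with
    | zero => simp only [key, h]
    | succ n =>
      simp only [key, h]
      by_cases hne : (P H ord (root H ord v)).Nonempty
      · have : par H ord u = par H ord v := by
          have gen : ∀ A A' : Set V, A = A' → ∀ (hA : A.Nonempty) (hA' : A'.Nonempty),
              hA.some = hA'.some := by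
            rintro A _ rfl _ _
            rfl
          have hne' : (P H ord (root H ord u)).Nonempty := h ▸ hne
          rw [par, par, dif_pos hne, dif_pos hne']
          exact gen _ _ (by rw [h]) _ _
        rw [this]
      · exfalso
        have hpos : ∃ x, H.Adj x v ∧ ord x < ord v := by
          by_contra hcon
          have := depth_zero hcon
          omega
        obtain ⟨x, hx1, hx2, hx3⟩ := depth_ex hpos
        exact hne ⟨x, hP _ _ ⟨hx1, hx3⟩⟩
  have hpar : ∀ u v, u ∈ P H ord v → key H ord (M+1) L (depth H ord v) v =
      key H ord (M+1) L (depth H ord u) u * (M + 1) + L (root H ord v) := by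
    intro u v h
    have h1 := hP _ _ h
    have h2 := par_mem h1
    have h3 : root H ord (par H ord v) = root H ord u := by
      by_cases he : par H ord v = u
      · rw [he]
      · exact hE.root_adj (hE.P_clique _ h2 h1 he)
    have h4 : depth H ord (par H ord v) = depth H ord u := by
      rw [← hd (par H ord v), h3, hd]
    rw [← hrr _ _ h3, h4, ← h.2]
    simp only [key]
  refine ⟨fun v => key H ord (M+1) L (depth H ord v) v, hrr,
    fun u v h => hrr _ _ (hE.root_adj h), ?_, ?_⟩
  · intro u v v' w hdd hu hw hlt
    simp only at hlt ⊢
    rw [hpar u v hu, hpar w v' hw]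
    exact mul_lex (hM' _) hlt
  · intro u v v' w hdd hu hw hlt hrk
    simp only at hlt ⊢
    rw [hpar u v hu, hpar w v' hw, hlt]
    have := (hL (root H ord v) (root H ord v')).2 (Or.inl hrk)
    omega

end

open Classical in
/-- Induction step. -/
lemma step {V : Type} [Finite V] {H : SimpleGraph V} {ord : V → ℕ} {k : ℕ} {α β : Type}
    (hE : Elim H ord k) (c : CL V (lay H ord) α β) :
    Nonempty (CL V H (Fin 3 × β × α) (Fin 2 × β × β)) := by
  obtain ⟨N, -, hN2, hN3, hN4⟩ := exists_N hE (fun r => c.rank (P H ord r))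
  obtain ⟨p1, hp1⟩ := lexcomb N c.pos
  obtain ⟨p, hp⟩ := lexcomb (depth H ord) p1
  have hP : ∀ u v, u ∈ P H ord v → u ∈ P H ord (root H ord v) :=
    fun u v h => (hE.root_props _ v le_rfl).2.1 h
  -- the crucial comparison between consecutive layers
  have cross : ∀ v w v' w', v ∈ P H ord w → v' ∈ P H ord w' →
      depth H ord w = depth H ord w' → c.track v = c.track v' →
      c.cl (P H ord (root H ord w)) = c.cl (P H ord (root H ord w')) →
      N w ≤ N w' → N v ≤ N v' ∧ (N v = N v' → c.pos v ≤ c.pos v') := by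
    intro v w v' w' hv hv' hd ht hc hN
    constructor
    · by_contra hlt
      have := hN3 v' w' w v hd.symm hv' hv (by omega)
      omega
    · intro he
      by_contra hlt
      by_cases hr : c.rank (P H ord (root H ord w)) ≤ c.rank (P H ord (root H ord w'))
      · exact hlt (c.nice _ _ (hE.P_clique _) (hE.P_clique _) hc hr v (hP _ _ hv) v' (hP _ _ hv') ht)
      · have := hN4 v' w' w v hd.symm hv' hv he.symm (by simpa using hr)
        omega
  have cross2 : ∀ v w v' w', v ∈ P H ord w → v' ∈ P H ord w' →
      depth H ord w % 3 = depth H ord w' % 3 → c.track v = c.track v' →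
      c.cl (P H ord (root H ord w)) = c.cl (P H ord (root H ord w')) →
      p w < p w' → p v' < p v → False := by
    intro v w v' w' hv hv' hd ht hc h1 h2
    rw [hp, hp1] at h1 h2
    have e1 := hv.2
    have e2 := hv'.2
    have hd' : depth H ord w = depth H ord w' := by omega
    have := cross v w v' w' hv hv' hd' ht hc (by omega)
    omega
  let tr : V → Fin 3 × β × α := fun v =>
    (⟨depth H ord v % 3, Nat.mod_lt _ (by norm_num)⟩, c.cl (P H ord (root H ord v)), c.track v)
  have htr : ∀ u v, tr u = tr v → depth H ord u % 3 = depth H ord v % 3 ∧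
      c.cl (P H ord (root H ord u)) = c.cl (P H ord (root H ord v)) ∧ c.track u = c.track v := by
    intro u v h
    simpa [tr] using h
  -- deepest vertex of a clique
  have hb : ∀ C : Set V, ∃ b : Option V, C.Nonempty →
      ∃ x ∈ C, b = some x ∧ ∀ v ∈ C, depth H ord v ≤ depth H ord x := by
    intro C
    by_cases h : C.Nonempty
    · obtain ⟨x, hx, hm⟩ := Set.exists_max_image C (depth H ord) (Set.toFinite _) h
      exact ⟨some x, fun _ => ⟨x, hx, rfl, hm⟩⟩
    · exact ⟨none, fun h' => absurd h' h⟩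
  choose b hb using hb
  let D : Set V → ℕ := fun C => (b C).elim 0 (depth H ord)
  let NN : Set V → ℕ := fun C => (b C).elim 0 N
  let K : Set V → β := fun C => (b C).elim (c.cl ∅) (fun x => c.cl (P H ord (root H ord x)))
  let B : Set V → Set V := fun C => {v | v ∈ C ∧ depth H ord v = D C}
  obtain ⟨r1, hr1⟩ := lexcomb NN (fun C => c.rank (B C))
  obtain ⟨r, hr⟩ := lexcomb D r1
  refine ⟨⟨tr, p, fun C => (⟨D C % 2, Nat.mod_lt _ (by norm_num)⟩, K C, c.cl (B C)), r,
    ?_, ?_, ?_, ?_⟩⟩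
  · intro v w ht hpos
    obtain ⟨h1, h2, h3⟩ := htr _ _ ht
    have a1 := hp v w
    have a2 := hp w v
    have a3 := hp1 v w
    have a4 := hp1 w v
    exact c.inj v w h3 (by omega)
  · intro v w h ht
    obtain ⟨h1, h2, h3⟩ := htr _ _ ht
    have l1 := hE.lip h
    have l2 := hE.lip h.symm
    have hd : depth H ord v = depth H ord w := by omega
    exact c.proper v w ⟨h, hd⟩ h3
  · intro v w x y hvw hxy t1 t2 p1' p2'
    obtain ⟨a1, a2, a3⟩ := htr _ _ t1
    obtain ⟨b1, b2, b3⟩ := htr _ _ t2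
    have l1 := hE.lip hvw
    have l2 := hE.lip hvw.symm
    have l3 := hE.lip hxy
    have l4 := hE.lip hxy.symm
    rcases lt_trichotomy (depth H ord v) (depth H ord w) with h | h | h
    · exact cross2 x y v w ⟨hxy, by omega⟩ ⟨hvw, by omega⟩ b1.symm a3.symm b2.symm p2' p1'
    · have h' : depth H ord x = depth H ord y := by omega
      rw [hp, hp1] at p1' p2'
      have e1 := hN2 v w ⟨hvw, h⟩
      have e2 := hN2 x y ⟨hxy, h'⟩
      exact c.noX v w x y ⟨hvw, h⟩ ⟨hxy, h'⟩ a3 b3 (by omega) (by omega)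
    · exact cross2 v w x y |> fun _ =>
        cross2 w v y x ⟨hvw.symm, by omega⟩ ⟨hxy.symm, by omega⟩ a1 b3 a2 p1' p2'
  · intro C C' hC hC' hcl hrank v hv v' hv' ht
    obtain ⟨a1, a2, a3⟩ := htr _ _ ht
    obtain ⟨x, hx, hbx, hmx⟩ := hb C ⟨v, hv⟩
    obtain ⟨x', hx', hbx', hmx'⟩ := hb C' ⟨v', hv'⟩
    have hD : D C = depth H ord x := by simp [D, hbx]
    have hD' : D C' = depth H ord x' := by simp [D, hbx']
    have hNN : NN C = N x := by simp [NN, hbx]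
    have hNN' : NN C' = N x' := by simp [NN, hbx']
    have hK : K C = c.cl (P H ord (root H ord x)) := by simp [K, hbx]
    have hK' : K C' = c.cl (P H ord (root H ord x')) := by simp [K, hbx']
    simp only [Prod.mk.injEq, Fin.mk.injEq] at hcl
    obtain ⟨c1, c2, c3⟩ := hcl
    have near : ∀ (C : Set V) (x v : V), H.IsClique C → x ∈ C → v ∈ C →
        (∀ v ∈ C, depth H ord v ≤ depth H ord x) →
        (depth H ord v = depth H ord x ∧ N v = N x) ∨ v ∈ P H ord x := by
      intro C x v hC hx hv hm
      by_cases he : v = x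
      · subst he; exact Or.inl ⟨rfl, rfl⟩
      have ha := hC hv hx he
      have h1 := hE.lip ha.symm
      have h2 := hm v hv
      by_cases hd : depth H ord v = depth H ord x
      · exact Or.inl ⟨hd, hN2 _ _ ⟨ha, hd⟩⟩
      · exact Or.inr ⟨ha, by omega⟩
    have n1 := near C x v hC hx hv hmx
    have n2 := near C' x' v' hC' hx' hv' hmx'
    have q1 := hr C' C
    have q2 := hr1 C' C
    rw [hD, hD'] at q1 c1
    rw [hNN, hNN'] at q2
    rw [hK, hK'] at c2
    by_contra hlt
    have hlt' : p v' < p v := by omega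
    rw [hp, hp1] at hlt'
    have hBcl : ∀ C : Set V, H.IsClique C → (lay H ord).IsClique (B C) :=
      fun C hC u hu w hw hne => ⟨hC hu.1 hw.1 hne, hu.2.trans hw.2.symm⟩
    have m1 := hmx v hv
    have m2 := hmx' v' hv'
    rcases n1 with ⟨n1, n1'⟩ | n1
    · rcases n2 with ⟨n2, n2'⟩ | n2
      · have := c.nice (B C) (B C') (hBcl C hC) (hBcl C' hC') c3
        have h4 : c.rank (B C) ≤ c.rank (B C') := by omega
        have h5 := this h4 v ⟨hv, by omega⟩ v' ⟨hv', by omega⟩ a3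
        omega
      · have := n2.2
        omega
    · rcases n2 with ⟨n2, n2'⟩ | n2
      · have := n1.2
        omega
      · have e1 := n1.2
        have e2 := n2.2
        have := cross v x v' x' n1 n2 (by omega) a3 c2 (by omega)
        omega

/-- Number of clique classes. -/
def S : ℕ → ℕ
  | 0 => 1
  | k + 1 => 2 * (S k * S k)

/-- Number of tracks. -/
def T : ℕ → ℕ
  | 0 => 1
  | k + 1 => 3 * (S k * T k)

lemma main {V : Type} [Finite V] (ord : V → ℕ) (k : ℕ) : ∀ H : SimpleGraph V, Elim H ord k →
    ∃ (α β : Type) (_ : Fintype α) (_ : Fintype β), Fintype.card α = T k ∧ Fintype.card β = S k ∧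
      Nonempty (CL V H α β) := by
  induction k with
  | zero =>
    intro H hE
    exact ⟨Unit, Unit, inferInstance, inferInstance, rfl, rfl, base hE⟩
  | succ k ih =>
    intro H hE
    obtain ⟨α, β, i1, i2, h1, h2, ⟨c⟩⟩ := ih (lay H ord) hE.lay_elim
    exact ⟨_, _, inferInstance, inferInstance, by simp [T, h1, h2], by simp [S, h2], step hE c⟩

lemma S_eq (k : ℕ) : S k * 2 = 2 ^ (2 ^ k) := by
  induction k with
  | zero => rfl
  | succ k ih =>
    rw [pow_succ 2 k, pow_mul, ← ih, S]
    ring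

lemma T_eq (k : ℕ) : T k * 2 ^ (k + 1) = 3 ^ k * 2 ^ (2 ^ k) := by
  induction k with
  | zero => rfl
  | succ k ih =>
    calc T (k + 1) * 2 ^ (k + 1 + 1) = 3 * (S k * 2) * (T k * 2 ^ (k + 1)) := by
          rw [T]; ring
      _ = _ := by
          rw [ih, S_eq, pow_succ 2 k, pow_mul]; ring

lemma exp_bound (k : ℕ) : 9 * 2 ^ k ≤ 4 ^ k + 6 * k + 8 := by
  rcases lt_or_ge k 4 with h | h
  · interval_cases k <;> norm_num
  · have h1 : 2 ^ 4 ≤ 2 ^ k := Nat.pow_le_pow_right (by norm_num) h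
    have h2 : 4 ^ k = 2 ^ k * 2 ^ k := by rw [← mul_pow]; norm_num
    rw [h2]
    nlinarith

lemma T_le (k : ℕ) : T k ≤ 3 ^ k * 6 ^ ((4 ^ k - 3 * k - 1) / 9) := by
  have h := exp_bound k
  have h' : 2 ^ k ≤ (4 ^ k - 3 * k - 1) / 9 + (k + 1) := by omega
  set e := (4 ^ k - 3 * k - 1) / 9
  have h2 : 2 ^ (2 ^ k) ≤ 2 ^ e * 2 ^ (k + 1) := by
    rw [← pow_add]
    exact Nat.pow_le_pow_right (by norm_num) h'
  have h3 : 2 ^ e ≤ 6 ^ e := Nat.pow_le_pow_left (by norm_num) e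
  have h4 : T k * 2 ^ (k + 1) ≤ (3 ^ k * 6 ^ e) * 2 ^ (k + 1) := by
    rw [T_eq, mul_assoc]
    exact Nat.mul_le_mul_left _ (h2.trans (Nat.mul_le_mul_right _ h3))
  exact Nat.le_of_mul_le_mul_right h4 (by positivity)

/-- In a rooted tree, connected sets are closed under parents (above their top). -/
lemma parent_mem {ι : Type} {T : SimpleGraph ι} (hT : T.IsTree) (z : ι) (A : Set ι)
    (hA : (T.induce A).Connected) {x y x' : ι} (hx : x ∈ A) (hy : y ∈ A) (hxy : y ≠ x)
    (hd : T.dist z y ≤ T.dist z x) (hadj : T.Adj x x') (hx' : T.dist z x' + 1 = T.dist z x) :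
    x' ∈ A := by
  classical
  obtain ⟨w⟩ := hA.preconnected ⟨x, hx⟩ ⟨y, hy⟩
  have hsupp : ∀ v ∈ (w.map (SimpleGraph.Embedding.induce A).toHom).support, v ∈ A := by
    intro v hv
    rw [SimpleGraph.Walk.support_map] at hv
    obtain ⟨a, -, rfl⟩ := List.mem_map.1 hv
    exact a.2
  let p : T.Walk x y := w.map (SimpleGraph.Embedding.induce A).toHom
  have short : ∀ y, y ≠ x → T.dist z y ≤ T.dist z x → ∃ q : T.Walk z y, x ∉ q.support := by
    intro y hyx hd
    obtain ⟨q, hq⟩ := hT.connected.exists_walk_length_eq_dist z y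
    refine ⟨q, fun hmem => ?_⟩
    have h1 := congrArg SimpleGraph.Walk.length (q.take_spec hmem)
    rw [SimpleGraph.Walk.length_append] at h1
    have h2 := SimpleGraph.dist_le (q.takeUntil x hmem)
    have h3 : (q.dropUntil x hmem).length = 0 := by omega
    exact hyx (SimpleGraph.Walk.eq_of_length_eq_zero h3).symm
  obtain ⟨q, hq⟩ := short y hxy hd
  obtain ⟨q', hq'⟩ := short x' hadj.ne' (by omega)
  have hbr := SimpleGraph.isAcyclic_iff_forall_adj_isBridge.1 hT.isAcyclic hadj
  have hbr' := (SimpleGraph.isBridge_iff_forall_walk_mem_edges.1 hbr)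
    (p.append (q.reverse.append q'))
  simp only [SimpleGraph.Walk.edges_append, List.mem_append, SimpleGraph.Walk.edges_reverse,
    List.mem_reverse] at hbr'
  rcases hbr' with h | h | h
  · exact hsupp _ (SimpleGraph.Walk.snd_mem_support_of_mem_edges p h)
  · exact absurd (SimpleGraph.Walk.fst_mem_support_of_mem_edges _ h) hq
  · exact absurd (SimpleGraph.Walk.fst_mem_support_of_mem_edges _ h) hq'

lemma exists_parent {ι : Type} {T : SimpleGraph ι} (hT : T.IsTree) (z x : ι)
    (h : T.dist z x ≠ 0) : ∃ x', T.Adj x x' ∧ T.dist z x' + 1 = T.dist z x := by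
  obtain ⟨q, hq⟩ := hT.connected.exists_walk_length_eq_dist x z
  rw [SimpleGraph.dist_comm] at hq
  cases q with
  | nil => simp at h
  | @cons _ x' _ ha q =>
    refine ⟨x', ha, ?_⟩
    have h1 := SimpleGraph.dist_le q.reverse
    have h2 := SimpleGraph.dist_le (q.reverse.append (SimpleGraph.Walk.cons ha.symm .nil))
    have h3 : T.dist z x ≤ T.dist z x' + 1 := by
      obtain ⟨r, hr⟩ := hT.connected.exists_walk_length_eq_dist z x'
      have := SimpleGraph.dist_le (r.append (SimpleGraph.Walk.cons ha.symm .nil))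
      simp at this
      omega
    simp at hq h1
    omega

lemma exists_elim {V : Type} [Fintype V] {G : SimpleGraph V} {k : ℕ} (D : TreeDecomp V G)
    (hD : ∀ x : D.ι, (D.bag x).ncard ≤ k + 1) :
    ∃ (H : SimpleGraph V) (ord : V → ℕ), G ≤ H ∧ Elim H ord k := by
  classical
  obtain ⟨z⟩ := D.isTree.connected.nonempty
  have htop : ∀ v : V, ∃ t, v ∈ D.bag t ∧ ∀ x, v ∈ D.bag x → D.tree.dist z t ≤ D.tree.dist z x := by
    intro v
    have := D.finι
    obtain ⟨t, ht, hm⟩ := Set.exists_min_image {x | v ∈ D.bag x} (D.tree.dist z)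
      (Set.toFinite _) (D.cover v)
    exact ⟨t, ht, hm⟩
  choose t ht htm using htop
  have claim : ∀ n, ∀ u v x, D.tree.dist z x ≤ n → u ∈ D.bag x → v ∈ D.bag x →
      D.tree.dist z (t u) ≤ D.tree.dist z (t v) → u ∈ D.bag (t v) := by
    intro n
    induction n with
    | zero =>
      intro u v x hx hu hv hle
      have h1 := htm v x hv
      have e1 : z = x := (D.isTree.connected.dist_eq_zero_iff).1 (by omega)
      have e2 : z = t v := (D.isTree.connected.dist_eq_zero_iff).1 (by omega)
      rw [← e2, e1]
      exact hu
    | succ n ih =>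
      intro u v x hx hu hv hle
      by_cases hxv : t v = x
      · rw [hxv]; exact hu
      have h1 := htm v x hv
      have h2 := htm u x hu
      have h0 : D.tree.dist z x ≠ 0 := by
        intro h0
        have e1 : z = x := (D.isTree.connected.dist_eq_zero_iff).1 (by omega)
        have e2 : z = t v := (D.isTree.connected.dist_eq_zero_iff).1 (by omega)
        exact hxv (e2.symm.trans e1)
      obtain ⟨x', ha, hx'⟩ := exists_parent D.isTree z x h0
      have hv' : v ∈ D.bag x' := parent_mem D.isTree z {x | v ∈ D.bag x} (D.subtreeConnected v)
        hv (ht v) hxv h1 ha hx'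
      have h3 := htm v x' hv'
      have hxu : t u ≠ x := by
        intro he
        rw [he] at hle
        omega
      have hu' : u ∈ D.bag x' := parent_mem D.isTree z {x | u ∈ D.bag x} (D.subtreeConnected u)
        hu (ht u) hxu h2 ha hx'
      exact ih u v x' (by omega) hu' hv' hle
  obtain ⟨ord, hord⟩ := lexcomb (fun v => D.tree.dist z (t v)) (fun v => (Fintype.equivFin V v).1)
  let H : SimpleGraph V :=
    { Adj := fun u v => u ≠ v ∧ ∃ x, u ∈ D.bag x ∧ v ∈ D.bag x
      symm := ⟨fun _ _ h => ⟨h.1.symm, h.2.imp fun _ hx => hx.symm⟩⟩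
      loopless := ⟨fun _ h => h.1 rfl⟩ }
  have hback : ∀ u v, H.Adj u v → ord u < ord v → u ∈ D.bag (t v) := by
    rintro u v ⟨-, x, hu, hv⟩ ho
    rw [hord] at ho
    exact claim _ u v x le_rfl hu hv (by omega)
  refine ⟨H, ord, fun u v h => ⟨h.ne, D.edgeCover u v h⟩, ?_, ?_, ?_⟩
  · intro u v h
    have h1 := hord u v
    have h2 := hord v u
    apply (Fintype.equivFin V).injective
    apply Fin.ext
    omega
  · intro v u w hu hw h1 h2 hne
    exact ⟨hne, t v, hback u v hu h1, hback w v hw h2⟩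
  · intro v
    have hs : insert v {u | H.Adj u v ∧ ord u < ord v} ⊆ D.bag (t v) := by
      rintro u (rfl | hu)
      · exact ht u
      · exact hback u v hu.1 hu.2
    have h1 := Set.ncard_le_ncard hs (Set.toFinite _)
    rw [Set.ncard_insert_of_notMem (fun h => lt_irrefl _ h.2) (Set.toFinite _)] at h1
    have := hD (t v)
    omega

/-- The trivial tree-decomposition. -/
lemma exists_decomp {V : Type} [Fintype V] (G : SimpleGraph V) :
    ∃ k, ∃ D : TreeDecomp V G, ∀ x : D.ι, (D.bag x).ncard ≤ k + 1 := by
  have hconn : ∀ S : Set Unit, S = Set.univ → ((⊥ : SimpleGraph Unit).induce S).Connected := by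
    rintro S rfl
    have : Nonempty (Set.univ : Set Unit) := ⟨⟨(), trivial⟩⟩
    exact ⟨fun a b => by rw [Subsingleton.elim a b]⟩
  refine ⟨Fintype.card V, ⟨Unit, inferInstance, ⊥, SimpleGraph.IsTree.of_subsingleton, fun _ => Set.univ,
    fun v => ⟨(), trivial⟩, fun v w _ => ⟨(), trivial, trivial⟩, fun v => hconn _ (by simp)⟩, ?_⟩
  intro x
  show (Set.univ : Set V).ncard ≤ _
  rw [Set.ncard_univ, Nat.card_eq_fintype_card]
  omega

end TL

/-- For every integer `k ≥ 0`, every graph `G` with tree-width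
`tw(G) ≤ k` has a `t_k`-track layout, where `t_k = 3^k ⬝ 6^((4^k - 3k - 1)/9)`;
hence track-number is bounded by a function of tree-width. -/
theorem track_layout_of_treewidth {V : Type} [Fintype V] (G : SimpleGraph V)
    (k : ℕ) (hk : treewidth V G ≤ k) :
    Nonempty (TrackLayout V G (3 ^ k * 6 ^ ((4 ^ k - 3 * k - 1) / 9))) := by
  obtain ⟨D, hD⟩ := Nat.sInf_mem (s := {k : ℕ | ∃ D : TreeDecomp V G,
    ∀ x : D.ι, (D.bag x).ncard ≤ k + 1}) (TL.exists_decomp G)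
  have hD' : ∀ x : D.ι, (D.bag x).ncard ≤ k + 1 :=
    fun x => (hD x).trans (Nat.succ_le_succ hk)
  obtain ⟨H, ord, hGH, hE⟩ := TL.exists_elim D hD'
  obtain ⟨α, β, i1, i2, h1, -, ⟨c⟩⟩ := TL.main ord k H hE
  have hle : Fintype.card α ≤ 3 ^ k * 6 ^ ((4 ^ k - 3 * k - 1) / 9) := h1 ▸ TL.T_le k
  let e : α ↪ Fin (3 ^ k * 6 ^ ((4 ^ k - 3 * k - 1) / 9)) :=
    (Fintype.equivFin α).toEmbedding.trans (Fin.castLEEmb hle)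
  refine ⟨⟨fun v => e (c.track v), c.pos, ?_, ?_, ?_⟩⟩
  · intro v w h1 h2
    exact c.inj v w (e.injective h1) h2
  · intro v w h h'
    exact c.proper v w (hGH h) (e.injective h')
  · intro v w x y h1 h2 h3 h4 _ h5 h6
    exact c.noX v w x y (hGH h1) (hGH h2) (e.injective h3) (e.injective h4) h5 h6
end

section
/- For every integer k ≥ 0, every graph G with tree-width tw(G) ≤ k has queue-number qn(G) ≤ 3^k · 6^{(4^k − 3k − 1)/9} − 1; hence queue-number is bounded by a function of tree-width, and graphs of bounded tree-width have bounded queue-number. -/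
open SimpleGraph

/-- A queue layout of `G` with `q` queues: a vertex-ordering (given by an injection
`ord : V → ℕ`) together with an assignment of the edges to queues `0, …, q-1`
such that no two edges in a common queue are nested. -/
structure QueueLayout (V : Type) (G : SimpleGraph V) (q : ℕ) where
  /-- the vertex-ordering -/
  ord : V → ℕ
  ordInj : Function.Injective ord
  /-- the queue assigned to each edge -/
  queue : V → V → ℕ
  queueSymm : ∀ v w : V, queue v w = queue w v
  queueLt : ∀ v w : V, G.Adj v w → queue v w < q
  /-- no two edges in a common queue are nested -/
  noNested : ∀ v w x y : V, G.Adj v w → G.Adj x y → queue v w = queue x y →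
    ord v < ord x → ord x < ord y → ord y < ord w → False
/-- The queue-number of `G`: the minimum number of queues in a queue layout of `G`. -/
noncomputable def queueNumber (V : Type) (G : SimpleGraph V) : ℕ :=
  sInf {q : ℕ | Nonempty (QueueLayout V G q)}
/-! ### Perfect elimination orderings and track layouts -/

/-- `rk` is a perfect elimination ordering of `H` with back-degree at most `k`. -/
structure IsPEO {V : Type} (H : SimpleGraph V) (rk : V → ℕ) (k : ℕ) : Prop where
  inj : Function.Injective rk
  clique : ∀ v u w, H.Adj v u → H.Adj v w → rk u < rk v → rk w < rk v → u ≠ w → H.Adj u w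
  card : ∀ v, {u | H.Adj v u ∧ rk u < rk v}.ncard ≤ k

/-- A track layout (`τ` the tracks, `ord` the order inside tracks) of `H` in which the set
of tracks covered by any nonempty clique is in the family `F`. -/
structure IsTrack {V A : Type} [DecidableEq A] (H : SimpleGraph V) (F : Finset (Finset A))
    (τ : V → A) (ord : V → ℕ) : Prop where
  inj : Function.Injective ord
  proper : ∀ v w, H.Adj v w → τ v ≠ τ w
  nocross : ∀ v w v' w', H.Adj v w → H.Adj v' w' → τ v = τ v' → τ w = τ w' →
    ord v < ord v' → ord w' < ord w → False
  cliques : ∀ Q : Finset V, Q.Nonempty → (∀ a ∈ Q, ∀ b ∈ Q, a ≠ b → H.Adj a b) →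
    Q.image τ ∈ F

/-- Layer of a vertex: distance to the root along the elimination ordering. -/
noncomputable def dep {V : Type} (H : SimpleGraph V) (rk : V → ℕ) (v : V) : ℕ :=
  sInf {n | ∃ u, ∃ _h : rk u < rk v, H.Adj v u ∧ n = dep H rk u + 1}
termination_by rk v

lemma dep_le {V : Type} {H : SimpleGraph V} {rk : V → ℕ} {v u : V} (h : H.Adj v u)
    (hr : rk u < rk v) : dep H rk v ≤ dep H rk u + 1 := by
  rw [dep]
  exact Nat.sInf_le ⟨u, hr, h, rfl⟩

lemma dep_exists {V : Type} {H : SimpleGraph V} {rk : V → ℕ} {v u : V} (h : H.Adj v u)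
    (hr : rk u < rk v) : ∃ w, H.Adj v w ∧ rk w < rk v ∧ dep H rk v = dep H rk w + 1 := by
  have hne : {n | ∃ u, ∃ _h : rk u < rk v, H.Adj v u ∧ n = dep H rk u + 1}.Nonempty :=
    ⟨_, u, hr, h, rfl⟩
  obtain ⟨w, h1, h2, h3⟩ := Nat.sInf_mem hne
  refine ⟨w, h2, h1, ?_⟩
  rw [← h3]
  conv_lhs => rw [dep]

lemma dep_pos_exists {V : Type} {H : SimpleGraph V} {rk : V → ℕ} {v : V}
    (h : dep H rk v ≠ 0) : ∃ w, H.Adj v w ∧ rk w < rk v ∧ dep H rk v = dep H rk w + 1 := by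
  by_cases hu : ∃ u, H.Adj v u ∧ rk u < rk v
  · obtain ⟨u, h1, h2⟩ := hu
    exact dep_exists h1 h2
  · exfalso
    apply h
    have : {n | ∃ u, ∃ _h : rk u < rk v, H.Adj v u ∧ n = dep H rk u + 1} = ∅ := by
      ext n
      simp only [Set.mem_ofPred_eq, Set.mem_empty_iff_false, iff_false]
      rintro ⟨u, h1, h2, -⟩
      exact hu ⟨u, h2, h1⟩
    rw [dep, this, Nat.sInf_empty]

lemma dep_adj {V : Type} {H : SimpleGraph V} {rk : V → ℕ} {k : ℕ} (P : IsPEO H rk k) :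
    ∀ (n : ℕ) (v u : V), rk v = n → H.Adj v u → rk u < rk v →
      dep H rk u = dep H rk v ∨ dep H rk u + 1 = dep H rk v := by
  intro n
  induction n using Nat.strong_induction_on with
  | _ n ih =>
    intro v u hn h hr
    have h1 := dep_le h hr
    obtain ⟨w, hw, hwr, hd⟩ := dep_exists h hr
    by_cases huw : u = w
    · subst huw; omega
    have ha := P.clique v u w h hw hr hwr huw
    rcases lt_or_ge (rk u) (rk w) with hlt | hge
    · have := ih (rk w) (hn ▸ hwr) w u rfl ha.symm hlt
      omega
    · have hlt : rk w < rk u := lt_of_le_of_ne hge (fun e => huw (P.inj e.symm))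
      have := ih (rk u) (hn ▸ hr) u w rfl ha hlt
      omega

lemma dep_adj_up {V : Type} {H : SimpleGraph V} {rk : V → ℕ} {k : ℕ} (P : IsPEO H rk k)
    {v u : V} (h : H.Adj v u) (hd : dep H rk u + 1 = dep H rk v) : rk u < rk v := by
  by_contra hc
  have hlt : rk v < rk u := lt_of_le_of_ne (not_lt.mp hc) (fun e => h.ne (P.inj e))
  have := dep_adj P _ u v rfl h.symm hlt
  omega

lemma dep_adj' {V : Type} {H : SimpleGraph V} {rk : V → ℕ} {k : ℕ} (P : IsPEO H rk k)
    {v u : V} (h : H.Adj v u) : dep H rk u = dep H rk v ∨ dep H rk u + 1 = dep H rk v ∨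
      dep H rk v + 1 = dep H rk u := by
  rcases lt_trichotomy (rk u) (rk v) with hlt | he | hlt
  · have := dep_adj P _ v u rfl h hlt
    omega
  · exact absurd (P.inj he) h.ne'
  · have := dep_adj P _ u v rfl h.symm hlt
    omega

/-- The subgraph of edges inside the layers. -/
def layerGraph {V : Type} (H : SimpleGraph V) (rk : V → ℕ) : SimpleGraph V where
  Adj v w := H.Adj v w ∧ dep H rk v = dep H rk w
  symm := ⟨fun _ _ h => ⟨h.1.symm, h.2.symm⟩⟩
  loopless := ⟨fun _ h => h.1.ne rfl⟩

lemma layerGraph_peo {V : Type} [Fintype V] {H : SimpleGraph V} {rk : V → ℕ} {k : ℕ}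
    (P : IsPEO H rk (k + 1)) : IsPEO (layerGraph H rk) rk k where
  inj := P.inj
  clique v u w h1 h2 h3 h4 h5 := ⟨P.clique v u w h1.1 h2.1 h3 h4 h5, h1.2.symm.trans h2.2⟩
  card v := by
    by_cases hu : ∃ u, H.Adj v u ∧ rk u < rk v
    · obtain ⟨u, h1, h2⟩ := hu
      obtain ⟨w, hw, hwr, hd⟩ := dep_exists h1 h2
      have hlt : {u | (layerGraph H rk).Adj v u ∧ rk u < rk v}.ncard <
          {u | H.Adj v u ∧ rk u < rk v}.ncard := by
        apply Set.ncard_lt_ncard _ (Set.toFinite _)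
        refine ⟨fun x hx => ⟨hx.1.1, hx.2⟩, fun hsub => ?_⟩
        have h := hsub (show w ∈ _ from ⟨hw, hwr⟩)
        have := h.1.2
        omega
      have := P.card v
      omega
    · have : {u | (layerGraph H rk).Adj v u ∧ rk u < rk v} = ∅ := by
        ext x
        simp only [Set.mem_ofPred_eq, Set.mem_empty_iff_false, iff_false]
        exact fun hx => hu ⟨x, hx.1.1, hx.2⟩
      rw [this]
      simp

lemma exists_rho {V : Type} {H : SimpleGraph V} {rk : V → ℕ} {k : ℕ}
    (P : IsPEO H rk k) : ∃ ρ : V → V,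
      (∀ v u, H.Adj v u → dep H rk v = dep H rk u → ρ v = ρ u) ∧
      (∀ v, rk (ρ v) ≤ rk v) ∧ (∀ v, dep H rk (ρ v) = dep H rk v) ∧
      (∀ v w, H.Adj v w → dep H rk w + 1 = dep H rk v → H.Adj (ρ v) w) := by
  classical
  let E : V → V → Prop := fun v u => H.Adj v u ∧ dep H rk u = dep H rk v ∧ rk u < rk v
  have hwf : WellFounded (fun a b : V => rk a < rk b) := (measure rk).wf
  let ρ : V → V := hwf.fix (fun v f => if h : ∃ u, E v u then
    f h.choose h.choose_spec.2.2 else v)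
  have hρ : ∀ v, ρ v = if h : ∃ u, E v u then ρ h.choose else v := fun v => by
    simp only [ρ]
    rw [hwf.fix_eq]
  have hind : ∀ v, (∀ u, E v u → ρ v = ρ u) ∧ rk (ρ v) ≤ rk v ∧
      dep H rk (ρ v) = dep H rk v ∧
      (∀ w, H.Adj v w → dep H rk w + 1 = dep H rk v → H.Adj (ρ v) w) := by
    intro v
    induction v using hwf.induction with
    | _ v ih =>
      by_cases h : ∃ u, E v u
      · have he : ρ v = ρ h.choose := by rw [hρ v, dif_pos h]
        have hs := h.choose_spec
        generalize h.choose = z at he hs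
        obtain ⟨i1, i2, i3, i4⟩ := ih z hs.2.2
        rw [he]
        refine ⟨?_, i2.trans hs.2.2.le, i3.trans hs.2.1, ?_⟩
        · intro u hu
          by_cases huz : z = u
          · rw [huz]
          have ha := P.clique v z u hs.1 hu.1 hs.2.2 hu.2.2 huz
          rcases lt_or_ge (rk u) (rk z) with hlt | hge
          · exact i1 u ⟨ha, hu.2.1.trans hs.2.1.symm, hlt⟩
          · have hlt : rk z < rk u := lt_of_le_of_ne hge (fun e => huz (P.inj e))
            exact ((ih u hu.2.2).1 z ⟨ha.symm, hs.2.1.trans hu.2.1.symm, hlt⟩).symm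
        · intro w hw hd
          have hne : z ≠ w := by
            rintro rfl
            have := hs.2.1
            omega
          refine i4 w (P.clique v z w hs.1 hw hs.2.2 (dep_adj_up P hw hd) hne) ?_
          rw [hs.2.1, hd]
      · have he : ρ v = v := by rw [hρ v, dif_neg h]
        rw [he]
        exact ⟨fun u hu => absurd ⟨u, hu⟩ h, le_rfl, rfl, fun w hw _ => hw⟩
  refine ⟨ρ, ?_, fun v => (hind v).2.1, fun v => (hind v).2.2.1, fun v => (hind v).2.2.2⟩
  intro v u h hd
  rcases lt_trichotomy (rk u) (rk v) with hlt | he | hlt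
  · exact (hind v).1 u ⟨h, hd.symm, hlt⟩
  · exact absurd (P.inj he) h.ne'
  · exact ((hind u).1 v ⟨h.symm, hd, hlt⟩).symm

/-- Piece keys. -/
lemma exists_key {V : Type} {H : SimpleGraph V} {rk : V → ℕ} {k : ℕ}
    (P : IsPEO H rk k) (ρ : V → V)
    (hρ1 : ∀ v u, H.Adj v u → dep H rk v = dep H rk u → ρ v = ρ u)
    (hρ2 : ∀ v, rk (ρ v) ≤ rk v) (B : ℕ) (σ : V → ℕ) : ∃ L : V → ℕ,
      (∀ v, ∃ q, L v = q * B + rk v) ∧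
      (∀ v u, H.Adj v u → dep H rk u + 1 = dep H rk v →
        L v = (L (ρ u) * B + σ v) * B + rk v) := by
  classical
  let E : V → V → Prop := fun v u => H.Adj v u ∧ dep H rk u + 1 = dep H rk v
  have hE : ∀ v u, E v u → rk (ρ u) < rk v := fun v u h =>
    (hρ2 u).trans_lt (dep_adj_up P h.1 h.2)
  have hwf : WellFounded (fun a b : V => rk a < rk b) := (measure rk).wf
  let L : V → ℕ := hwf.fix (fun v f => if h : ∃ u, E v u then
    (f (ρ h.choose) (hE v _ h.choose_spec) * B + σ v) * B + rk v else 0 * B + rk v)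
  have hL : ∀ v, L v = if h : ∃ u, E v u then
      (L (ρ h.choose) * B + σ v) * B + rk v else 0 * B + rk v := fun v => by
    simp only [L]
    rw [hwf.fix_eq]
  refine ⟨L, fun v => ?_, fun v u h hd => ?_⟩
  · rw [hL v]
    split_ifs
    · exact ⟨_, rfl⟩
    · exact ⟨_, rfl⟩
  · have hex : ∃ u, E v u := ⟨u, h, hd⟩
    rw [hL v, dif_pos hex]
    have hs := hex.choose_spec
    generalize hex.choose = z at hs
    have : ρ z = ρ u := by
      by_cases hzu : z = u
      · rw [hzu]
      · have h2 := hs.2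
        exact hρ1 z u (P.clique v z u hs.1 h (dep_adj_up P hs.1 hs.2) (dep_adj_up P h hd) hzu)
          (by omega)
    rw [this]

lemma enc_le {B a b x y : ℕ} (hx : x < B) (hy : y < B) (h : a * B + x ≤ b * B + y) :
    a ≤ b := by
  by_contra hc
  have : (b + 1) * B ≤ a * B := Nat.mul_le_mul_right B (by omega)
  rw [Nat.add_mul] at this
  omega

/-- Two cliques covering the same tracks are ordered. -/
lemma sum_lt {V A : Type} [DecidableEq A] {H : SimpleGraph V} {F : Finset (Finset A)}
    {τ : V → A} {ord : V → ℕ} (T : IsTrack H F τ ord) (C C' : Finset V)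
    (hC : ∀ a ∈ C, ∀ b ∈ C, a ≠ b → H.Adj a b)
    (hC' : ∀ a ∈ C', ∀ b ∈ C', a ≠ b → H.Adj a b)
    (hS : C.image τ = C'.image τ) {v v' : V} (hv : v ∈ C) (hv' : v' ∈ C') (ht : τ v = τ v')
    (hlt : ord v < ord v') : ∑ x ∈ C, ord x < ∑ x ∈ C', ord x := by
  have inj : ∀ a ∈ C, ∀ b ∈ C, τ a = τ b → a = b := fun a ha b hb e => by
    by_contra hne
    exact T.proper a b (hC a ha b hb hne) e
  have inj' : ∀ a ∈ C', ∀ b ∈ C', τ a = τ b → a = b := fun a ha b hb e => by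
    by_contra hne
    exact T.proper a b (hC' a ha b hb hne) e
  have hex : ∀ x, ∃ y, x ∈ C → y ∈ C' ∧ τ y = τ x := fun x => by
    by_cases hx : x ∈ C
    · have : τ x ∈ C'.image τ := hS ▸ Finset.mem_image_of_mem τ hx
      obtain ⟨y, hy, e⟩ := Finset.mem_image.mp this
      exact ⟨y, fun _ => ⟨hy, e⟩⟩
    · exact ⟨x, fun h => absurd h hx⟩
  choose e he using hex
  have hsum : ∑ x ∈ C, ord (e x) = ∑ x ∈ C', ord x := by
    refine Finset.sum_nbij e (fun x hx => (he x hx).1) ?_ ?_ (fun _ _ => rfl)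
    · intro a ha b hb hab
      refine inj a ha b hb ?_
      rw [← (he a ha).2, ← (he b hb).2, hab]
    · intro y hy
      have : τ y ∈ C.image τ := hS ▸ Finset.mem_image_of_mem τ hy
      obtain ⟨x, hx, hxy⟩ := Finset.mem_image.mp this
      exact ⟨x, hx, inj' _ (he x hx).1 _ hy ((he x hx).2.trans hxy)⟩
  have hev : e v = v' := inj' _ (he v hv).1 _ hv' ((he v hv).2.trans ht)
  rw [← hsum]
  refine Finset.sum_lt_sum (fun x hx => ?_) ⟨v, hv, by rw [hev]; exact hlt⟩
  by_contra hc
  push Not at hc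
  have hxv : v ≠ x := by
    rintro rfl
    rw [hev] at hc
    omega
  have hev' : v' ≠ e x := by
    intro h
    apply hxv
    refine inj v hv x hx ?_
    rw [ht, h, (he x hx).2]
  exact T.nocross v x v' (e x) (hC v hv x hx hxv) (hC' v' hv' _ (he x hx).1 hev') ht
    (he x hx).2.symm hlt hc

lemma step {V : Type} [Fintype V] {H : SimpleGraph V} {rk : V → ℕ} {k : ℕ}
    (P : IsPEO H rk k) {A : Type} [Fintype A] [DecidableEq A] (F : Finset (Finset A))
    (hF : F.Nonempty) (τ : V → A) (ord : V → ℕ) (T : IsTrack (layerGraph H rk) F τ ord) :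
    ∃ (F' : Finset (Finset (ZMod 3 × {x // x ∈ F} × A))) (τ' : V → ZMod 3 × {x // x ∈ F} × A)
      (ord' : V → ℕ), F'.Nonempty ∧ F'.card ≤ 6 * F.card ^ 4 ∧ IsTrack H F' τ' ord' := by
  classical
  obtain ⟨ρ, hρ1, hρ2, hρ3, hρ4⟩ := exists_rho P
  set d := dep H rk with hd
  let N : V → Finset V := fun r => Finset.univ.filter (fun u => H.Adj r u ∧ d u + 1 = d r)
  have hN : ∀ r u, u ∈ N r ↔ H.Adj r u ∧ d u + 1 = d r := fun r u => by simp [N]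
  have hNc : ∀ r, ∀ a ∈ N r, ∀ b ∈ N r, a ≠ b → (layerGraph H rk).Adj a b := by
    intro r a ha b hb hab
    rw [hN] at ha hb
    exact ⟨P.clique r a b ha.1 hb.1 (dep_adj_up P ha.1 ha.2) (dep_adj_up P hb.1 hb.2) hab,
      show d a = d b by have := ha.2; have := hb.2; omega⟩
  let σ : V → ℕ := fun r => ∑ u ∈ N r, ord u
  obtain ⟨B, hB⟩ : ∃ B, ∀ v, ord v < B ∧ rk v < B ∧ σ v < B := by
    refine ⟨∑ v, (ord v + rk v + σ v) + 1, fun v => ?_⟩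
    have := Finset.single_le_sum (f := fun v => ord v + rk v + σ v)
      (fun _ _ => Nat.zero_le _) (Finset.mem_univ v)
    omega
  obtain ⟨L, hL1, hL2⟩ := exists_key P ρ hρ1 hρ2 B σ
  rw [← hd] at hL2
  let K : V → ℕ := fun v => L (ρ v) * B + ord v
  obtain ⟨M, hM⟩ : ∃ M, ∀ v, K v < M := by
    refine ⟨∑ v, K v + 1, fun v => ?_⟩
    have := Finset.single_le_sum (f := K) (fun _ _ => Nat.zero_le _) (Finset.mem_univ v)
    omega
  have hLinj : ∀ r r', L r = L r' → r = r' := by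
    intro r r' h
    obtain ⟨q, hq⟩ := hL1 r
    obtain ⟨q', hq'⟩ := hL1 r'
    rw [hq, hq'] at h
    have h1 := enc_le (hB r).2.1 (hB r').2.1 h.le
    have h2 := enc_le (hB r').2.1 (hB r).2.1 h.ge
    have h3 := le_antisymm h1 h2
    subst h3
    exact P.inj (by omega)
  have hKle : ∀ v v', K v ≤ K v' → L (ρ v) ≤ L (ρ v') := fun v v' h =>
    enc_le (hB v).1 (hB v').1 h
  let o : V → ℕ := fun v => d v * M + K v
  have hod : ∀ v v', o v ≤ o v' → d v ≤ d v' := fun v v' h => enc_le (hM v) (hM v') h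
  have hoK : ∀ v v', o v < o v' → d v = d v' → K v < K v' := by
    intro v v' h e
    simp only [o, e] at h
    omega
  have hSex : ∀ r, ∃ s : {x // x ∈ F}, (N r).Nonempty → s.1 = (N r).image τ := by
    intro r
    by_cases h : (N r).Nonempty
    · exact ⟨⟨_, T.cliques _ h (hNc r)⟩, fun _ => rfl⟩
    · exact ⟨⟨hF.choose, hF.choose_spec⟩, fun h' => absurd h' h⟩
  choose S hS using hSex
  let τ' : V → ZMod 3 × {x // x ∈ F} × A := fun v => ((d v : ZMod 3), S (ρ v), τ v)
  have hτ' : ∀ v w, τ' v = τ' w → d v % 3 = d w % 3 ∧ S (ρ v) = S (ρ w) ∧ τ v = τ w := by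
    intro v w h
    simp only [τ', Prod.mk.injEq] at h
    exact ⟨(ZMod.natCast_eq_natCast_iff' _ _ 3).mp h.1, h.2.1, h.2.2⟩
  let f : Bool × ZMod 3 × {x // x ∈ F} × {x // x ∈ F} × {x // x ∈ F} × {x // x ∈ F} →
      Finset (ZMod 3 × {x // x ∈ F} × A) := fun p =>
    p.2.2.2.1.1.image (fun j => (p.2.1, p.2.2.1, j)) ∪
      if p.1 = true then p.2.2.2.2.2.1.image (fun j => (p.2.1 + 1, p.2.2.2.2.1, j)) else ∅
  have hadj : ∀ v w, H.Adj v w → d w = d v ∨ d w + 1 = d v ∨ d v + 1 = d w :=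
    fun v w h => dep_adj' P h
  have hcross : ∀ v w v' w', H.Adj v w → H.Adj v' w' → d v + 1 = d w → d v' + 1 = d w' →
      d v = d v' → S (ρ w) = S (ρ w') → τ v = τ v' → K v < K v' → K w' < K w → False := by
    intro v w v' w' h h' hd1 hd2 hd3 hSS ht hK1 hK2
    have e1 := hρ4 w v h.symm hd1
    have e2 := hρ4 w' v' h'.symm hd2
    have m1 : v ∈ N (ρ w) := (hN _ _).2 ⟨e1, by rw [hρ3]; exact hd1⟩
    have m2 : v' ∈ N (ρ w') := (hN _ _).2 ⟨e2, by rw [hρ3]; exact hd2⟩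
    have l1 := hL2 (ρ w) v e1 (by rw [hρ3]; exact hd1)
    have l2 := hL2 (ρ w') v' e2 (by rw [hρ3]; exact hd2)
    have a1 := hKle _ _ hK1.le
    have a2 := hKle _ _ hK2.le
    rw [l1, l2] at a2
    have a3 := enc_le (hB _).2.1 (hB _).2.1 a2
    have a4 := enc_le (hB _).2.2 (hB _).2.2 a3
    have a5 := le_antisymm a1 a4
    have hlt : ord v < ord v' := by
      simp only [K, a5] at hK1
      omega
    have himg : (N (ρ w)).image τ = (N (ρ w')).image τ := by
      rw [← hS _ ⟨v, m1⟩, ← hS _ ⟨v', m2⟩, hSS]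
    have := sum_lt T (N (ρ w)) (N (ρ w')) (hNc _) (hNc _) himg m1 m2 ht hlt
    rw [a5] at a3
    have : σ (ρ w) < σ (ρ w') := this
    omega
  refine ⟨Finset.univ.image f, τ', o, ?_, ?_, ?_, ?_, ?_, ?_⟩
  · have : Nonempty {x // x ∈ F} := ⟨⟨hF.choose, hF.choose_spec⟩⟩
    exact Finset.univ_nonempty.image f
  · refine Finset.card_image_le.trans (le_of_eq ?_)
    rw [Finset.card_univ]
    simp only [Fintype.card_prod, Fintype.card_bool, ZMod.card, Fintype.card_coe]
    ring
  · intro v w h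
    have h1 := le_antisymm (hod _ _ h.le) (hod _ _ h.ge)
    have h2 : K v = K w := by
      simp only [o, h1] at h
      omega
    have h3 := le_antisymm (hKle _ _ h2.le) (hKle _ _ h2.ge)
    apply T.inj
    simp only [K, h3] at h2
    omega
  · intro v w h e
    obtain ⟨e1, -, e3⟩ := hτ' _ _ e
    rcases hadj v w h with h1 | h1 | h1
    · exact T.proper v w ⟨h, h1.symm⟩ e3
    · omega
    · omega
  · intro v w v' w' h h' e1 e2 o1 o2
    obtain ⟨a1, a2, a3⟩ := hτ' _ _ e1
    obtain ⟨b1, b2, b3⟩ := hτ' _ _ e2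
    have c1 := hod _ _ o1.le
    have c2 := hod _ _ o2.le
    have g := hadj v w h
    have g' := hadj v' w' h'
    have hvv : d v = d v' := by omega
    have hww : d w = d w' := by omega
    have K1 := hoK _ _ o1 hvv
    have K2 := hoK _ _ o2 hww.symm
    rcases g with g | g | g
    · have r1 := hρ1 v w h g.symm
      have r2 := hρ1 v' w' h' (by omega)
      have l1 := hKle _ _ K1.le
      have l2 := hKle _ _ K2.le
      rw [← r1, ← r2] at l2
      have l3 := le_antisymm l1 l2
      refine T.nocross v w v' w' ⟨h, g.symm⟩ ⟨h', show d v' = d w' by omega⟩ a3 b3 ?_ ?_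
      · simp only [K, l3] at K1
        omega
      · simp only [K, ← r1, ← r2, l3] at K2
        omega
    · exact hcross w' v' w v h'.symm h.symm (by omega) (by omega) hww.symm a2.symm b3.symm K2 K1
    · exact hcross v w v' w' h h' (by omega) (by omega) hvv b2 a3 K1 K2
  · intro Q hQ hc
    obtain ⟨m, hm, hmin⟩ := Finset.exists_min_image Q d hQ
    have hdQ : ∀ x ∈ Q, d x = d m ∨ d x = d m + 1 := by
      intro x hx
      by_cases hxm : m = x
      · subst hxm; left; rfl
      · have := hadj m x (hc m hm x hx hxm)
        have := hmin x hx
        omega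
    let Q0 := Q.filter (fun x => d x = d m)
    let Q1 := Q.filter (fun x => d x = d m + 1)
    have hQ0 : Q0.image τ ∈ F := by
      refine T.cliques _ ⟨m, by simp [Q0, hm]⟩ ?_
      intro a ha b hb hab
      simp only [Q0, Finset.mem_filter] at ha hb
      exact ⟨hc a ha.1 b hb.1 hab, ha.2.trans hb.2.symm⟩
    have hρQ : ∀ x ∈ Q, ∀ y ∈ Q, d x = d y → ρ x = ρ y := by
      intro x hx y hy e
      by_cases hxy : x = y
      · rw [hxy]
      · exact hρ1 x y (hc x hx y hy hxy) e
    rw [Finset.mem_image]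
    by_cases hne : Q1.Nonempty
    · have hQ1 : Q1.image τ ∈ F := by
        refine T.cliques _ hne ?_
        intro a ha b hb hab
        simp only [Q1, Finset.mem_filter] at ha hb
        exact ⟨hc a ha.1 b hb.1 hab, ha.2.trans hb.2.symm⟩
      obtain ⟨z, hz⟩ := hne
      simp only [Q1, Finset.mem_filter] at hz
      refine ⟨(true, (d m : ZMod 3), S (ρ m), ⟨_, hQ0⟩, S (ρ z), ⟨_, hQ1⟩),
        Finset.mem_univ _, ?_⟩
      simp only [f, if_true, Finset.image_image]
      have : Q = Q0 ∪ Q1 := by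
        ext x
        simp only [Q0, Q1, Finset.mem_union, Finset.mem_filter]
        have := hdQ x
        tauto
      conv_rhs => rw [this, Finset.image_union]
      congr 1
      · refine Finset.image_congr ?_
        intro x hx
        simp only [Q0, Finset.coe_filter, Set.mem_ofPred_eq] at hx
        simp only [Function.comp, τ', hx.2, hρQ x hx.1 m hm hx.2]
      · refine Finset.image_congr ?_
        intro x hx
        simp only [Q1, Finset.coe_filter, Set.mem_ofPred_eq] at hx
        simp only [Function.comp, τ', hx.2, hρQ x hx.1 z hz.1 (hx.2.trans hz.2.symm),
          Nat.cast_add, Nat.cast_one]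
    · refine ⟨(false, (d m : ZMod 3), S (ρ m), ⟨_, hQ0⟩, S (ρ m), ⟨_, hQ0⟩),
        Finset.mem_univ _, ?_⟩
      simp only [f, Finset.image_image]
      have : Q = Q0 := by
        ext x
        simp only [Q0, Finset.mem_filter]
        have h1 := hdQ x
        have h2 : ¬ (x ∈ Q ∧ d x = d m + 1) := fun h => hne ⟨x, by simpa [Q1] using h⟩
        tauto
      conv_rhs => rw [this]
      simp only [Bool.false_eq_true, if_false, Finset.union_empty]
      refine Finset.image_congr ?_
      intro x hx
      simp only [Q0, Finset.coe_filter, Set.mem_ofPred_eq] at hx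
      simp only [Function.comp, τ', hx.2, hρQ x hx.1 m hm hx.2]

/-- Number of track sets of cliques. -/
def cNum : ℕ → ℕ
  | 0 => 1
  | k + 1 => 6 * cNum k ^ 4

/-- Number of tracks. -/
def tNum : ℕ → ℕ
  | 0 => 1
  | k + 1 => 3 * (cNum k * tNum k)

lemma tNum_eq (k : ℕ) : tNum k = 3 ^ k * 6 ^ ((4 ^ k - 3 * k - 1) / 9) := by
  have key : ∀ k, ∃ e g, 9 * e + 3 * k + 1 = 4 ^ k ∧ 3 * g + 1 = 4 ^ k ∧ cNum k = 6 ^ g ∧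
      tNum k = 3 ^ k * 6 ^ e := by
    intro k
    induction k with
    | zero => exact ⟨0, 0, by norm_num, by norm_num, rfl, rfl⟩
    | succ k ih =>
      obtain ⟨e, g, h1, h2, h3, h4⟩ := ih
      refine ⟨e + g, 4 * g + 1, ?_, ?_, ?_, ?_⟩
      · rw [pow_succ]; omega
      · rw [pow_succ]; omega
      · rw [cNum, h3]; ring
      · rw [tNum, h3, h4]; ring
  obtain ⟨e, g, h1, -, -, h4⟩ := key k
  rw [h4]
  congr 2
  omega

lemma exists_track {V : Type} [Fintype V] (rk : V → ℕ) (k : ℕ) :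
    ∀ H : SimpleGraph V, IsPEO H rk k →
    ∃ (A : Type) (_ : Fintype A) (_ : DecidableEq A) (F : Finset (Finset A)) (τ : V → A)
      (ord : V → ℕ), F.Nonempty ∧ Fintype.card A ≤ tNum k ∧ F.card ≤ cNum k ∧
      IsTrack H F τ ord := by
  classical
  induction k with
  | zero =>
    intro H P
    have hno : ∀ v w, ¬ H.Adj v w := by
      have aux : ∀ v w, H.Adj v w → rk w < rk v → False := by
        intro v w h hr
        have := P.card v
        have h0 := (Set.ncard_eq_zero (Set.toFinite _)).mp (Nat.le_zero.mp this)
        have : w ∈ {u | H.Adj v u ∧ rk u < rk v} := ⟨h, hr⟩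
        rw [h0] at this
        exact this
      intro v w h
      rcases lt_trichotomy (rk w) (rk v) with hlt | he | hlt
      · exact aux v w h hlt
      · exact h.ne' (P.inj he)
      · exact aux w v h.symm hlt
    refine ⟨Unit, inferInstance, inferInstance, {{()}}, fun _ => (), rk, by simp, by simp [tNum],
      by simp [cNum], P.inj, fun v w h => absurd h (hno v w),
      fun v w _ _ h => absurd h (hno v w), ?_⟩
    intro Q hQ _
    rw [Finset.mem_singleton]
    ext x
    obtain ⟨a, ha⟩ := hQ
    simp only [Finset.mem_image, Finset.mem_singleton]
    exact ⟨fun _ => trivial, fun _ => ⟨a, ha, trivial⟩⟩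
  | succ k ih =>
    intro H P
    obtain ⟨A, i1, i2, F, τ, ord, h1, h2, h3, h4⟩ := ih _ (layerGraph_peo P)
    obtain ⟨F', τ', ord', g1, g2, g3⟩ := step P F h1 τ ord h4
    refine ⟨_, inferInstance, inferInstance, F', τ', ord', g1, ?_, ?_, g3⟩
    · simp only [Fintype.card_prod, ZMod.card, Fintype.card_coe, tNum]
      gcongr
    · refine g2.trans ?_
      rw [cNum]
      gcongr

/-- A track layout gives a queue layout. -/
lemma queue_of_track {V : Type} [Fintype V] {G H : SimpleGraph V} (hGH : G ≤ H) {A : Type}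
    [Fintype A] [DecidableEq A] {F : Finset (Finset A)} {τ : V → A} {ord : V → ℕ}
    (T : IsTrack H F τ ord) : Nonempty (QueueLayout V G (Fintype.card A - 1)) := by
  classical
  let t : V → ℕ := fun v => (Fintype.equivFin A (τ v)).1
  have ht : ∀ v w, t v = t w → τ v = τ w := fun v w h =>
    (Fintype.equivFin A).injective (Fin.ext h)
  have htlt : ∀ v, t v < Fintype.card A := fun v => (Fintype.equivFin A (τ v)).2
  obtain ⟨B, hB⟩ : ∃ B, ∀ v, ord v < B := by
    refine ⟨∑ v, ord v + 1, fun v => ?_⟩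
    have := Finset.single_le_sum (f := ord) (fun _ _ => Nat.zero_le _) (Finset.mem_univ v)
    omega
  have hle : ∀ v w, t v * B + ord v ≤ t w * B + ord w → t v ≤ t w := fun v w h =>
    enc_le (hB v) (hB w) h
  have hne : ∀ v w, G.Adj v w → t v ≠ t w := fun v w h e => T.proper v w (hGH h) (ht _ _ e)
  refine ⟨⟨fun v => t v * B + ord v, ?_, fun v w => (t v - t w) + (t w - t v) - 1, ?_, ?_, ?_⟩⟩
  · intro v w h
    dsimp only at h
    have e := le_antisymm (hle _ _ h.le) (hle _ _ h.ge)
    rw [e] at h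
    exact T.inj (by omega)
  · intro v w
    omega
  · intro v w h
    have := hne v w h
    have := htlt v
    have := htlt w
    omega
  · intro v w x y h1 h2 hq o1 o2 o3
    have a1 := hle _ _ o1.le
    have a2 := hle _ _ o2.le
    have a3 := hle _ _ o3.le
    have n1 := hne v w h1
    have n2 := hne x y h2
    have e1 : t v = t x := by omega
    have e2 : t w = t y := by omega
    rw [e1] at o1
    rw [e2] at o3
    exact T.nocross v w x y (hGH h1) (hGH h2) (ht _ _ e1) (ht _ _ e2) (by omega) (by omega)

/-! ### From tree-decompositions to perfect elimination orderings -/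

/-- Every node of a geodesic other than its start is strictly closer to the end. -/
lemma geodesic_support {ι : Type} {T : SimpleGraph ι} {t r y : ι}
    (q : T.Walk t r) (hq : q.length = T.dist t r) (hy : y ∈ q.support) :
    y = t ∨ T.dist y r < T.dist t r := by
  classical
  have h1 := congrArg SimpleGraph.Walk.length (q.take_spec hy)
  rw [SimpleGraph.Walk.length_append] at h1
  have h2 := SimpleGraph.dist_le (q.dropUntil y hy)
  rcases Nat.eq_zero_or_pos (q.takeUntil y hy).length with h0 | h0
  · left
    exact (SimpleGraph.Walk.eq_of_length_eq_zero h0).symm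
  · right
    omega

/-- The path from a node `x` of a connected set `S` to the root passes through
the node `t` of `S` nearest to the root, and is within `S` before. -/
lemma exists_path_through {ι : Type} {T : SimpleGraph ι} (hT : T.IsTree) (r : ι) (S : Set ι)
    (hS : (T.induce S).Connected) (t : ι) (ht : t ∈ S)
    (hmin : ∀ y ∈ S, T.dist t r ≤ T.dist y r) (x : ι) (hx : x ∈ S) :
    ∃ p : T.Walk x r, p.IsPath ∧ t ∈ p.support ∧
      ∀ y ∈ p.support, y ∈ S ∨ T.dist y r < T.dist t r := by
  classical
  obtain ⟨w⟩ := hS.preconnected ⟨x, hx⟩ ⟨t, ht⟩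
  let p0 : T.Walk x t := w.toPath.1.map (SimpleGraph.Embedding.induce S).toHom
  have hp0 : p0.IsPath :=
    SimpleGraph.Walk.IsPath.map (f := (SimpleGraph.Embedding.induce S).toHom)
      (SimpleGraph.Embedding.induce (G := T) S).injective w.toPath.2
  have hp0S : ∀ y ∈ p0.support, y ∈ S := by
    intro y hy
    have h1 : p0.support = w.toPath.1.support.map (SimpleGraph.Embedding.induce S).toHom :=
      SimpleGraph.Walk.support_map (SimpleGraph.Embedding.induce S).toHom w.toPath.1
    rw [h1] at hy
    obtain ⟨z, -, hz⟩ := List.mem_map.mp hy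
    rw [← hz]
    exact z.2
  obtain ⟨q, hq⟩ := hT.connected.exists_walk_length_eq_dist t r
  have hqp : q.IsPath := SimpleGraph.Walk.isPath_of_length_eq_dist q hq
  refine ⟨p0.append q, ?_, ?_, ?_⟩
  · rw [SimpleGraph.Walk.isPath_def, SimpleGraph.Walk.support_append]
    have hn := hqp.support_nodup
    rw [← SimpleGraph.Walk.cons_tail_support] at hn
    rw [List.nodup_cons] at hn
    refine List.Nodup.append hp0.support_nodup hn.2 ?_
    intro y hy1 hy2
    rcases geodesic_support q hq (List.mem_of_mem_tail hy2) with h | h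
    · subst h
      exact hn.1 hy2
    · exact absurd (hmin y (hp0S y hy1)) (not_le.mpr h)
  · rw [SimpleGraph.Walk.mem_support_append_iff]
    exact Or.inl p0.end_mem_support
  · intro y hy
    rw [SimpleGraph.Walk.mem_support_append_iff] at hy
    rcases hy with hy | hy
    · exact Or.inl (hp0S y hy)
    · rcases geodesic_support q hq hy with h | h
      · subst h
        exact Or.inl ht
      · exact Or.inr h

lemma exists_peo {V : Type} [Fintype V] {G : SimpleGraph V} {k : ℕ} (D : TreeDecomp V G)
    (hD : ∀ x : D.ι, (D.bag x).ncard ≤ k + 1) :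
    ∃ (H : SimpleGraph V) (rk : V → ℕ), G ≤ H ∧ IsPEO H rk k := by
  classical
  have := D.finι
  obtain ⟨r⟩ := D.isTree.connected.nonempty
  have hex : ∀ v : V, ∃ t, v ∈ D.bag t ∧ ∀ y, v ∈ D.bag y → D.tree.dist t r ≤ D.tree.dist y r := by
    intro v
    obtain ⟨x, hx⟩ := D.cover v
    obtain ⟨t, ht, hm⟩ := Set.exists_min_image {x | v ∈ D.bag x} (fun y => D.tree.dist y r)
      (Set.toFinite _) ⟨x, hx⟩
    exact ⟨t, ht, hm⟩
  choose t ht hmin using hex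
  let n := Fintype.card V
  let e : V → ℕ := fun v => (Fintype.equivFin V v).1
  have he : ∀ v, e v < n := fun v => (Fintype.equivFin V v).2
  let rk : V → ℕ := fun v => D.tree.dist (t v) r * n + e v
  have hrk : ∀ u v, rk u ≤ rk v → D.tree.dist (t u) r ≤ D.tree.dist (t v) r :=
    fun u v h => enc_le (he u) (he v) h
  let H : SimpleGraph V :=
    { Adj := fun v w => v ≠ w ∧ ∃ x, v ∈ D.bag x ∧ w ∈ D.bag x
      symm := ⟨fun _ _ h => ⟨h.1.symm, h.2.choose, h.2.choose_spec.2, h.2.choose_spec.1⟩⟩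
      loopless := ⟨fun _ h => h.1 rfl⟩ }
  have key : ∀ v u, H.Adj v u → rk u < rk v → u ∈ D.bag (t v) := by
    rintro v u ⟨-, x, hxv, hxu⟩ hr
    have hle := hrk u v hr.le
    obtain ⟨p, hp, hp1, -⟩ := exists_path_through D.isTree r {y | v ∈ D.bag y}
      (D.subtreeConnected v) (t v) (ht v) (hmin v) x hxv
    obtain ⟨p', hp', -, hp2⟩ := exists_path_through D.isTree r {y | u ∈ D.bag y}
      (D.subtreeConnected u) (t u) (ht u) (hmin u) x hxu
    have hpp : p = p' := (D.isTree.existsUnique_path x r).unique hp hp'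
    rw [hpp] at hp1
    rcases hp2 _ hp1 with h | h
    · exact h
    · omega
  refine ⟨H, rk, ?_, ?_, ?_, ?_⟩
  · intro v w h
    exact ⟨h.ne, D.edgeCover v w h⟩
  · intro u v h
    have h1 := le_antisymm (hrk u v h.le) (hrk v u h.ge)
    simp only [rk, h1] at h
    exact (Fintype.equivFin V).injective (Fin.ext (by simp only [e] at h; omega))
  · intro v u w h1 h2 h3 h4 h5
    exact ⟨h5, t v, key v u h1 h3, key v w h2 h4⟩
  · intro v
    have hlt : {u | H.Adj v u ∧ rk u < rk v}.ncard < (D.bag (t v)).ncard := by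
      apply Set.ncard_lt_ncard _ (Set.toFinite _)
      refine ⟨fun x hx => key v x hx.1 hx.2, fun hsub => ?_⟩
      exact (hsub (ht v)).1.1 rfl
    have := hD (t v)
    omega

/-- The trivial tree-decomposition shows that the tree-width is attained. -/
lemma exists_decomp {V : Type} [Fintype V] (G : SimpleGraph V) :
    ∃ D : TreeDecomp V G, ∀ x : D.ι, (D.bag x).ncard ≤ treewidth V G + 1 := by
  have hne : {k : ℕ | ∃ D : TreeDecomp V G, ∀ x : D.ι, (D.bag x).ncard ≤ k + 1}.Nonempty := by
    refine ⟨Fintype.card V, ⟨Unit, inferInstance, ⊥, SimpleGraph.IsTree.of_subsingleton,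
      fun _ => Set.univ, fun v => ⟨(), trivial⟩, fun v w _ => ⟨(), trivial, trivial⟩, ?_⟩, ?_⟩
    · intro v
      have : Nonempty {x : Unit | v ∈ (Set.univ : Set V)} := ⟨⟨(), trivial⟩⟩
      exact ⟨SimpleGraph.Preconnected.of_subsingleton⟩
    · intro x
      simp [Set.ncard_univ]
  exact Nat.sInf_mem hne

/-- For every integer `k ≥ 0`, every graph `G` with tree-width
`tw(G) ≤ k` has queue-number `qn(G) ≤ 3^k ⬝ 6^((4^k - 3k - 1)/9) - 1`; hence
queue-number is bounded by a function of tree-width, and graphs of bounded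
tree-width have bounded queue-number. -/
theorem queueNumber_le_of_treewidth {V : Type} [Fintype V] (G : SimpleGraph V)
    (k : ℕ) (hk : treewidth V G ≤ k) :
    queueNumber V G ≤ 3 ^ k * 6 ^ ((4 ^ k - 3 * k - 1) / 9) - 1 := by
  obtain ⟨D, hD⟩ := exists_decomp G
  obtain ⟨H, rk, hGH, P⟩ := exists_peo (k := k) D (fun x => (hD x).trans (by omega))
  obtain ⟨A, _, _, F, τ, ord, -, hA, -, T⟩ := exists_track rk k H P
  rw [← tNum_eq]
  exact (Nat.sInf_le (queue_of_track hGH T)).trans (Nat.sub_le_sub_right hA 1)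
end
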